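/- Let K_{1,n−1} be the star graph on n ≥ 2 vertices. Then the c-dominating energy of K_{1,n−1} is E_{D_c}(K_{1,n−1}) = √(4n − 3). -/

import Mathlib

open Finset Matrix

set_option linter.unusedSectionVars false

variable {V : Type*} [Fintype V] [DecidableEq V]

/-- `D` is a dominating set of `G`: every vertex is in `D` or adjacent to a vertex of `D`. -/
def IsDominatingSet (G : SimpleGraph V) (D : Finset V) : Prop :=
  ∀ v : V, v ∈ D ∨ ∃ u ∈ D, G.Adj u v

/-- `D` is a connected dominating set: a dominating set inducing a connected subgraph. -/
def IsConnectedDominatingSet (G : SimpleGraph V) (D : Finset V) : Prop :=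
  IsDominatingSet G D ∧ (G.induce (D : Set V)).Connected

/-- `D` is a minimum dominating set of `G`. -/
def IsMinimumDominatingSet (G : SimpleGraph V) (D : Finset V) : Prop :=
  IsDominatingSet G D ∧ ∀ D' : Finset V, IsDominatingSet G D' → D.card ≤ D'.card

/-- `D` is a minimum connected dominating set of `G`. -/
def IsMinimumConnectedDominatingSet (G : SimpleGraph V) (D : Finset V) : Prop :=
  IsConnectedDominatingSet G D ∧
    ∀ D' : Finset V, IsConnectedDominatingSet G D' → D.card ≤ D'.card

/-- The (minimum/connected) dominating matrix of `G` w.r.t. a set `D`: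
entry `(i,j)` is `1` if `i` is adjacent to `j`, `1` if `i = j ∈ D`, and `0` otherwise. -/
def domMatrix (G : SimpleGraph V) [DecidableRel G.Adj] (D : Finset V) : Matrix V V ℝ :=
  Matrix.of fun i j =>
    if i = j then (if i ∈ D then 1 else 0) else (if G.Adj i j then 1 else 0)

theorem domMatrix_isHermitian (G : SimpleGraph V) [DecidableRel G.Adj] (D : Finset V) :
    (domMatrix G D).IsHermitian := by
  show (domMatrix G D)ᴴ = domMatrix G D
  ext i j
  simp only [Matrix.conjTranspose_apply, domMatrix, Matrix.of_apply, star_trivial]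
  rcases eq_or_ne i j with rfl | h
  · simp
  · rw [if_neg (Ne.symm h), if_neg h]
    simp only [G.adj_comm j i]

/-- The eigenvalues of the dominating matrix (real, since the matrix is symmetric). -/
noncomputable def domEigen (G : SimpleGraph V) [DecidableRel G.Adj] (D : Finset V) : V → ℝ :=
  (domMatrix_isHermitian G D).eigenvalues

/-- The (c-)dominating energy: the sum of the absolute values of the eigenvalues
of the dominating matrix. -/
noncomputable def domEnergy (G : SimpleGraph V) [DecidableRel G.Adj] (D : Finset V) : ℝ :=
  ∑ i, |domEigen G D i|

/-- A support vertex: a vertex adjacent to a pendant vertex (a vertex of degree 1). -/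
def IsSupportVertex (G : SimpleGraph V) [DecidableRel G.Adj] (v : V) : Prop :=
  ∃ u, G.Adj v u ∧ G.degree u = 1

/-- The sum of the squares of the eigenvalues of a real symmetric matrix is the trace of its
square. -/
theorem Matrix.IsHermitian.trace_mul_self_eq_sum_sq_eigenvalues {A : Matrix V V ℝ}
    (hA : A.IsHermitian) : (A * A).trace = ∑ i, hA.eigenvalues i ^ 2 := by
  conv_lhs => rw [hA.spectral_theorem, ← map_mul, Unitary.conjStarAlgAut_apply,
    Matrix.trace_mul_cycle, Unitary.coe_star_mul_self, one_mul]
  simp [Matrix.diagonal_mul_diagonal, Matrix.trace_diagonal, sq]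

section Star

variable {G : SimpleGraph V} [DecidableRel G.Adj] {c : V}

theorem domMatrix_star_apply (hG : ∀ i j : V, G.Adj i j ↔ i ≠ j ∧ (i = c ∨ j = c)) (i j : V) :
    domMatrix G {c} i j = if i = c ∨ j = c then 1 else 0 := by
  by_cases h : i = j
  · subst h; simp [domMatrix]
  · simp [domMatrix, h, hG]

theorem domMatrix_star_mulVec_center (hG : ∀ i j : V, G.Adj i j ↔ i ≠ j ∧ (i = c ∨ j = c))
    (v : V → ℝ) : (domMatrix G {c} *ᵥ v) c = ∑ j, v j := by
  simp [Matrix.mulVec, dotProduct, domMatrix_star_apply hG]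

theorem domMatrix_star_mulVec_leaf (hG : ∀ i j : V, G.Adj i j ↔ i ≠ j ∧ (i = c ∨ j = c))
    (v : V → ℝ) {i : V} (hi : i ≠ c) : (domMatrix G {c} *ᵥ v) i = v c := by
  simp [Matrix.mulVec, dotProduct, domMatrix_star_apply hG, hi]

theorem trace_domMatrix_star (hG : ∀ i j : V, G.Adj i j ↔ i ≠ j ∧ (i = c ∨ j = c)) :
    (domMatrix G {c}).trace = 1 := by
  simp [Matrix.trace, domMatrix_star_apply hG]

theorem sum_ite_eq_center_add (a b : ℝ) :
    ∑ i : V, (if i = c then a else b) = a + (Fintype.card V - 1) * b := by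
  have h : ∀ i : V, (if i = c then a else b) = (if i = c then a - b else 0) + b := by
    intro i; split_ifs <;> ring
  simp only [h, Finset.sum_add_distrib, Finset.sum_ite_eq', Finset.sum_const, Finset.mem_univ,
    Finset.card_univ, nsmul_eq_mul, if_true]
  ring

theorem trace_domMatrix_star_mul_self (hG : ∀ i j : V, G.Adj i j ↔ i ≠ j ∧ (i = c ∨ j = c)) :
    (domMatrix G {c} * domMatrix G {c}).trace = 2 * (Fintype.card V : ℝ) - 1 := by
  have h : ∀ i : V, (domMatrix G {c} * domMatrix G {c}) i i =
      if i = c then (Fintype.card V : ℝ) else 1 := by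
    intro i
    by_cases hi : i = c <;> simp [Matrix.mul_apply, domMatrix_star_apply hG, hi]
  simp only [Matrix.trace, Matrix.diag_apply, h, sum_ite_eq_center_add]
  ring

/-- Every eigenvalue of the dominating matrix of a star is either zero or a root of
`x ^ 2 - x - (|V| - 1)`. -/
theorem domEigen_star (hG : ∀ i j : V, G.Adj i j ↔ i ≠ j ∧ (i = c ∨ j = c)) (k : V) :
    domEigen G {c} k = 0 ∨
      domEigen G {c} k ^ 2 = domEigen G {c} k + (Fintype.card V - 1) := by
  set l := domEigen G {c} k
  set v : V → ℝ := ⇑((domMatrix_isHermitian G {c}).eigenvectorBasis k)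
  have hv : domMatrix G {c} *ᵥ v = l • v :=
    (domMatrix_isHermitian G {c}).mulVec_eigenvectorBasis k
  have hv0 : v ≠ 0 := (WithLp.ofLp_eq_zero 2).ne.2 <|
    (domMatrix_isHermitian G {c}).eigenvectorBasis.orthonormal.ne_zero k
  have hcenter : ∑ j, v j = l * v c := by
    rw [← domMatrix_star_mulVec_center hG, hv, Pi.smul_apply, smul_eq_mul]
  have hleaf : ∀ i, i ≠ c → l * v i = v c := fun i hi => by
    rw [← domMatrix_star_mulVec_leaf hG v hi, hv, Pi.smul_apply, smul_eq_mul]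
  by_cases hc : v c = 0
  · left
    obtain ⟨i, hi⟩ := Function.ne_iff.mp hv0
    have hic : i ≠ c := by rintro rfl; exact hi hc
    exact (mul_eq_zero.mp ((hleaf i hic).trans hc)).resolve_right hi
  · right
    have hsum : ∑ j, l * v j = l * v c + (Fintype.card V - 1) * v c := by
      rw [← sum_ite_eq_center_add (c := c)]
      refine Finset.sum_congr rfl fun j _ => ?_
      split_ifs with hj
      · rw [hj]
      · exact hleaf j hj
    rw [← Finset.mul_sum, hcenter] at hsum
    apply mul_right_cancel₀ hc
    linear_combination hsum

theorem domEnergy_star_center (hG : ∀ i j : V, G.Adj i j ↔ i ≠ j ∧ (i = c ∨ j = c)) :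
    domEnergy G {c} = Real.sqrt (4 * (Fintype.card V : ℝ) - 3) := by
  have hcard : (1 : ℝ) ≤ Fintype.card V := by
    exact_mod_cast Fintype.card_pos_iff.mpr ⟨c⟩
  set s := Real.sqrt (4 * (Fintype.card V : ℝ) - 3)
  have hs : s ^ 2 = 4 * (Fintype.card V : ℝ) - 3 := Real.sq_sqrt (by linarith)
  have hs0 : 0 < s := Real.sqrt_pos.mpr (by linarith)
  have habs : ∀ k, |domEigen G {c} k| * s = 2 * domEigen G {c} k ^ 2 - domEigen G {c} k := by
    intro k
    rcases domEigen_star hG k with h | h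
    · simp [h]
    · have hsq : |2 * domEigen G {c} k - 1| = s := by
        rw [← Real.sqrt_sq_eq_abs]
        congr 1
        linear_combination 4 * h
      rw [← hsq, ← abs_mul, abs_of_nonneg]
      · ring
      · nlinarith [sq_nonneg (domEigen G {c} k)]
  have hsum : ∑ k, domEigen G {c} k = 1 := by
    rw [← trace_domMatrix_star hG, (domMatrix_isHermitian G {c}).trace_eq_sum_eigenvalues]
    rfl
  have hsum_sq : ∑ k, domEigen G {c} k ^ 2 = 2 * (Fintype.card V : ℝ) - 1 := by
    rw [← trace_domMatrix_star_mul_self hG,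
      (domMatrix_isHermitian G {c}).trace_mul_self_eq_sum_sq_eigenvalues]
    rfl
  apply mul_right_cancel₀ hs0.ne'
  rw [domEnergy, Finset.sum_mul, Finset.sum_congr rfl fun k _ => habs k,
    Finset.sum_sub_distrib, ← Finset.mul_sum, hsum, hsum_sq]
  linear_combination -hs

/-- A minimum connected dominating set of a star is a single vertex, which is a center. -/
theorem exists_center_of_isMinimumConnectedDominatingSet {D : Finset V}
    (hG : ∀ i j : V, G.Adj i j ↔ i ≠ j ∧ (i = c ∨ j = c))
    (hD : IsMinimumConnectedDominatingSet G D) :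
    ∃ d, D = {d} ∧ ∀ i j : V, G.Adj i j ↔ i ≠ j ∧ (i = d ∨ j = d) := by
  obtain ⟨⟨hdom, hconn⟩, hmin⟩ := hD
  have hc : IsConnectedDominatingSet G {c} := by
    refine ⟨fun v => ?_, ?_⟩
    · by_cases h : v = c
      · simp [h]
      · exact Or.inr ⟨c, by simp, (hG c v).mpr ⟨Ne.symm h, Or.inl rfl⟩⟩
    · rw [Finset.coe_singleton]
      exact SimpleGraph.Connected.of_subsingleton
  obtain ⟨⟨d, hd⟩⟩ := hconn.nonempty
  have hDd : D = {d} :=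
    (Finset.eq_of_subset_of_card_le (Finset.singleton_subset_iff.mpr hd)
      (by simpa using hmin _ hc)).symm
  refine ⟨d, hDd, fun i j => ?_⟩
  subst hDd
  have hstar : ∀ v, v = d ∨ d = c ∨ v = c := fun v => by
    rcases hdom v with h | ⟨u, hu, h⟩
    · exact Or.inl (Finset.mem_singleton.mp h)
    · rw [Finset.mem_singleton] at hu
      subst hu
      exact Or.inr ((hG _ _).mp h).2
  rw [hG]
  have hi := hstar i
  have hj := hstar j
  grind

end Star

/-- For the star graph `K_{1,n−1}` on `n ≥ 2` vertices (center `c₀` adjacent to all other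
vertices, and no other edges), the c-dominating energy is `E_{D_c}(K_{1,n−1}) = √(4n − 3)`. -/
theorem cDomEnergy_star (n : ℕ) (hn : 2 ≤ n)
    (G : SimpleGraph (Fin n)) [DecidableRel G.Adj]
    (c₀ : Fin n) (hG : ∀ i j : Fin n, G.Adj i j ↔ i ≠ j ∧ (i = c₀ ∨ j = c₀))
    (Dc : Finset (Fin n)) (hDc : IsMinimumConnectedDominatingSet G Dc) :
    domEnergy G Dc = Real.sqrt (4 * (n : ℝ) - 3) := by
  obtain ⟨d, rfl, hd⟩ := exists_center_of_isMinimumConnectedDominatingSet hG hDc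
  simpa using domEnergy_star_center hd
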